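/- arXiv:1403.3955 — 3 statements merged into one kernel-verified Lean document; each statement's English description precedes it below -/
import Mathlib

section
/- Let M : 𝓗₀ → 𝓗₁ and T : 𝓗₁ → 𝓗₀ be bounded operators and set m₀ := P_{𝓗₁,H₀} ∘ M ∘ ι_{H₀,𝓗₀}. Define S₁ : 𝓗₀ → H₀ ⊕ H by S₁h := ((P_{𝓗₁,H₀}∘M − (i/2)·P_Ĥ∘P_{𝓗₀,H₀})h, −P_{𝓗₀,H}h); S₂ : H₀ ⊕ H → 𝓗₁ by S₂(h₀, y) := M(ι_{H₀,𝓗₀}h₀) + (i/2)·ι_{H₀,𝓗₁}(P_Ĥh₀) − ι_{H,𝓗₁}y; Ω̃ : 𝓗₀ ⊕ 𝓗₁ → 𝓗₁ ⊕ 𝓗₀ by Ω̃(h, k) := ((M + M∘T∘M)h − ((1/2)·I_{𝓗₁} + M∘T)k, −((1/2)·I_{𝓗₀} + T∘M)h + Tk); X₁ : 𝓗₁ ⊕ 𝓗₀ → H₀ ⊕ H by X₁(k, h) := (P_{𝓗₁,H₀}k + (i/2)·P_Ĥ(P_{𝓗₀,H₀}h), P_{𝓗₀,H}h); and X₂ :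 𝓗₀ ⊕ 𝓗₁ → H₀ ⊕ H by X₂(h, k) := (P_{𝓗₀,H₀}h + (i/2)·P_Ĥ(P_{𝓗₁,H₀}k), P_{𝓗₁,H}k). Then X₁ ∘ Ω̃ ∘ X₂* = Ω₀ + S₁ ∘ T ∘ S₂. (This is the pointwise operator identity of Proposition 4.9: with M = M₊(λ) and T = T_τ(λ) = −(τ₊(λ) + M₊(λ))^{-1}, it states that the characteristic matrix Ω_τ(λ) = Ω₀(λ) + S₁(λ)T_τ(λ)S₂(λ) admits the representation Ω_τ(λ) = X₁ Ω̃_τ(λ) X₂*.) -/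
open ContinuousLinearMap

set_option synthInstance.maxHeartbeats 1000000
set_option maxHeartbeats 1000000

noncomputable section

/-- The Hilbert space direct sum `A ⊕ B`. -/
abbrev l2 (A B : Type*) := WithLp 2 (A × B)

/-- The element `(a, b)` of the Hilbert direct sum `A ⊕ B`. -/
def mk2 {A B : Type*} (a : A) (b : B) : l2 A B := (WithLp.equiv 2 (A × B)).symm (a, b)

section maps

variable (A B : Type*)
  [NormedAddCommGroup A] [InnerProductSpace ℂ A]
  [NormedAddCommGroup B] [InnerProductSpace ℂ B]

/-- The orthogonal projection `A ⊕ B → A` onto the first summand. -/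
def fstL : l2 A B →L[ℂ] A :=
  (ContinuousLinearMap.fst ℂ A B) ∘L
    (WithLp.prodContinuousLinearEquiv 2 ℂ A B).toContinuousLinearMap

/-- The orthogonal projection `A ⊕ B → B` onto the second summand. -/
def sndL : l2 A B →L[ℂ] B :=
  (ContinuousLinearMap.snd ℂ A B) ∘L
    (WithLp.prodContinuousLinearEquiv 2 ℂ A B).toContinuousLinearMap

/-- The inclusion `A → A ⊕ B` of the first summand. -/
def inlL : A →L[ℂ] l2 A B :=
  (WithLp.prodContinuousLinearEquiv 2 ℂ A B).symm.toContinuousLinearMap ∘L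
    (ContinuousLinearMap.inl ℂ A B)

/-- The inclusion `B → A ⊕ B` of the second summand. -/
def inrL : B →L[ℂ] l2 A B :=
  (WithLp.prodContinuousLinearEquiv 2 ℂ A B).symm.toContinuousLinearMap ∘L
    (ContinuousLinearMap.inr ℂ A B)

end maps

variable {H Hh Htb : Type*}
  [NormedAddCommGroup H] [InnerProductSpace ℂ H] [FiniteDimensional ℂ H]
  [NormedAddCommGroup Hh] [InnerProductSpace ℂ Hh] [FiniteDimensional ℂ Hh]
  [NormedAddCommGroup Htb] [InnerProductSpace ℂ Htb] [FiniteDimensional ℂ Htb]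

/-- `P_Ĥ = ι_{Ĥ,H₀} ∘ P_{H₀,Ĥ} : H₀ → H₀` where `H₀ = H ⊕ Ĥ`. -/
def PHh : l2 H Hh →L[ℂ] l2 H Hh := inrL H Hh ∘L sndL H Hh

theorem aux_fst_inl (A B : Type*) [NormedAddCommGroup A] [InnerProductSpace ℂ A]
    [NormedAddCommGroup B] [InnerProductSpace ℂ B] (a : A) :
    fstL A B (inlL A B a) = a := rfl

theorem aux_inner {A B : Type*} [NormedAddCommGroup A] [InnerProductSpace ℂ A]
    [NormedAddCommGroup B] [InnerProductSpace ℂ B] (a a' : A) (b b' : B) :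
    inner ℂ (mk2 a b) (mk2 a' b') = inner ℂ a a' + inner ℂ b b' := rfl

theorem aux_inner_inl {A B : Type*} [NormedAddCommGroup A] [InnerProductSpace ℂ A]
    [NormedAddCommGroup B] [InnerProductSpace ℂ B] (x : l2 A B) (a : A) :
    inner ℂ x (inlL A B a) = inner ℂ (fstL A B x) a := by
  have : inner ℂ x (inlL A B a) = inner ℂ (fstL A B x) a + inner ℂ (sndL A B x) (0 : B) := rfl
  rw [this, inner_zero_right, add_zero]

theorem aux_inner_P {A B : Type*} [NormedAddCommGroup A] [InnerProductSpace ℂ A]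
    [NormedAddCommGroup B] [InnerProductSpace ℂ B] (x y : l2 A B) :
    inner ℂ ((inrL A B ∘L sndL A B) x) y = inner ℂ x ((inrL A B ∘L sndL A B) y) := by
  have h1 : inner ℂ ((inrL A B ∘L sndL A B) x) y
    = inner ℂ (0 : A) (fstL A B y) + inner ℂ (sndL A B x) (sndL A B y) := rfl
  have h2 : inner ℂ x ((inrL A B ∘L sndL A B) y)
    = inner ℂ (fstL A B x) (0 : A) + inner ℂ (sndL A B x) (sndL A B y) := rfl
  rw [h1, h2, inner_zero_right, inner_zero_left]

theorem aux_mk2_add {A B : Type*} [NormedAddCommGroup A] [InnerProductSpace ℂ A]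
    [NormedAddCommGroup B] [InnerProductSpace ℂ B] (a a' : A) (b b' : B) :
    mk2 a b + mk2 a' b' = mk2 (a + a') (b + b') := rfl

theorem aux_surj {A B : Type*} (x : l2 A B) : ∃ a b, x = mk2 a b := ⟨x.fst, x.snd, rfl⟩

/-- the operator identity of Proposition 4.9: `X₁ ∘ Ω̃ ∘ X₂* = Ω₀ + S₁ ∘ T ∘ S₂`. -/
theorem statement8
    -- `H_b` is a subspace of `H̃_b`, `𝓗₀ = H₀ ⊕ H̃_b`, `𝓗₁ = H₀ ⊕ H_b`
    (Hb : Submodule ℂ Htb)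
    (M : l2 (l2 H Hh) Htb →L[ℂ] l2 (l2 H Hh) Hb)
    (T : l2 (l2 H Hh) Hb →L[ℂ] l2 (l2 H Hh) Htb)
    -- `m₀ := P_{𝓗₁,H₀} ∘ M ∘ ι_{H₀,𝓗₀}`
    (m₀ : l2 H Hh →L[ℂ] l2 H Hh)
    (hm₀ : m₀ = fstL (l2 H Hh) Hb ∘L M ∘L inlL (l2 H Hh) Htb)
    -- `S₁ : 𝓗₀ → H₀ ⊕ H`
    (S₁ : l2 (l2 H Hh) Htb →L[ℂ] l2 (l2 H Hh) H)
    (hS₁ : ∀ h : l2 (l2 H Hh) Htb,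
      S₁ h = mk2 ((fstL (l2 H Hh) Hb ∘L M -
          (Complex.I / 2) • (PHh ∘L fstL (l2 H Hh) Htb)) h)
        (-(fstL H Hh (fstL (l2 H Hh) Htb h))))
    -- `S₂ : H₀ ⊕ H → 𝓗₁`
    (S₂ : l2 (l2 H Hh) H →L[ℂ] l2 (l2 H Hh) Hb)
    (hS₂ : ∀ (h₀ : l2 H Hh) (y : H),
      S₂ (mk2 h₀ y) = M (inlL (l2 H Hh) Htb h₀) +
        (Complex.I / 2) • inlL (l2 H Hh) Hb (PHh h₀) - inlL (l2 H Hh) Hb (inlL H Hh y))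
    -- `Ω̃ : 𝓗₀ ⊕ 𝓗₁ → 𝓗₁ ⊕ 𝓗₀`
    (Ωt : l2 (l2 (l2 H Hh) Htb) (l2 (l2 H Hh) Hb) →L[ℂ]
      l2 (l2 (l2 H Hh) Hb) (l2 (l2 H Hh) Htb))
    (hΩt : ∀ (h : l2 (l2 H Hh) Htb) (k : l2 (l2 H Hh) Hb),
      Ωt (mk2 h k) = mk2
        ((M + M ∘L T ∘L M) h -
          ((1 / 2 : ℂ) • ContinuousLinearMap.id ℂ (l2 (l2 H Hh) Hb) + M ∘L T) k)
        (-(((1 / 2 : ℂ) • ContinuousLinearMap.id ℂ (l2 (l2 H Hh) Htb) + T ∘L M) h) + T k))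
    -- `X₁ : 𝓗₁ ⊕ 𝓗₀ → H₀ ⊕ H`
    (X₁ : l2 (l2 (l2 H Hh) Hb) (l2 (l2 H Hh) Htb) →L[ℂ] l2 (l2 H Hh) H)
    (hX₁ : ∀ (k : l2 (l2 H Hh) Hb) (h : l2 (l2 H Hh) Htb),
      X₁ (mk2 k h) = mk2
        (fstL (l2 H Hh) Hb k + (Complex.I / 2) • PHh (fstL (l2 H Hh) Htb h))
        (fstL H Hh (fstL (l2 H Hh) Htb h)))
    -- `X₂ : 𝓗₀ ⊕ 𝓗₁ → H₀ ⊕ H`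
    (X₂ : l2 (l2 (l2 H Hh) Htb) (l2 (l2 H Hh) Hb) →L[ℂ] l2 (l2 H Hh) H)
    (hX₂ : ∀ (h : l2 (l2 H Hh) Htb) (k : l2 (l2 H Hh) Hb),
      X₂ (mk2 h k) = mk2
        (fstL (l2 H Hh) Htb h + (Complex.I / 2) • PHh (fstL (l2 H Hh) Hb k))
        (fstL H Hh (fstL (l2 H Hh) Hb k)))
    -- `Ω₀ : H₀ ⊕ H → H₀ ⊕ H`
    (Ω₀ : l2 (l2 H Hh) H →L[ℂ] l2 (l2 H Hh) H)
    (hΩ₀ : ∀ (h₀ : l2 H Hh) (y : H),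
      Ω₀ (mk2 h₀ y) = mk2 (m₀ h₀ - (1 / 2 : ℂ) • inlL H Hh y) (-(1 / 2 : ℂ) • fstL H Hh h₀)) :
    X₁ ∘L Ωt ∘L adjoint X₂ = Ω₀ + S₁ ∘L T ∘L S₂ := by
  have hadj : ∀ (h₀ : l2 H Hh) (y : H), adjoint X₂ (mk2 h₀ y) =
      mk2 (inlL (l2 H Hh) Htb h₀)
        (inlL (l2 H Hh) Hb (-((Complex.I / 2) • PHh h₀) + inlL H Hh y)) := by
    intro h₀ y
    refine ext_inner_left ℂ fun v => ?_
    obtain ⟨h, k, rfl⟩ := aux_surj v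
    rw [adjoint_inner_right, hX₂, aux_inner, aux_inner, aux_inner_inl, aux_inner_inl,
      inner_add_left, inner_add_right, aux_inner_inl, inner_neg_right, inner_smul_left,
      inner_smul_right, PHh, aux_inner_P]
    have : (starRingEnd ℂ) (Complex.I / 2) = -(Complex.I / 2) := by
      apply Complex.ext <;> simp [Complex.div_re, Complex.div_im]
      norm_num
    rw [this]
    ring
  ext1 v
  obtain ⟨h₀, y, rfl⟩ := aux_surj v
  have hS : S₂ (mk2 h₀ y) = M (inlL (l2 H Hh) Htb h₀) -
      inlL (l2 H Hh) Hb (-((Complex.I / 2) • PHh h₀) + inlL H Hh y) := by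
    rw [hS₂, map_add, map_neg, map_smul]
    abel
  simp only [ContinuousLinearMap.comp_apply, ContinuousLinearMap.add_apply]
  have hP : fstL H Hh (PHh h₀) = 0 := rfl
  rw [hadj, hΩt, hX₁, hΩ₀, hS₁, aux_mk2_add, hS, hm₀]
  congr 1
  · simp only [ContinuousLinearMap.comp_apply, ContinuousLinearMap.add_apply,
      ContinuousLinearMap.sub_apply, ContinuousLinearMap.smul_apply,
      ContinuousLinearMap.id_apply, map_add, map_sub, map_neg, map_smul, aux_fst_inl]
    module
  · simp only [ContinuousLinearMap.comp_apply, ContinuousLinearMap.add_apply,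
      ContinuousLinearMap.sub_apply, ContinuousLinearMap.smul_apply,
      ContinuousLinearMap.id_apply, map_add, map_sub, map_neg, map_smul, aux_fst_inl]
    module
end
end

section
/- Let M, τ : 𝓗 → 𝓗 be bounded operators such that τ + M is boundedly invertible, set K := (τ + M)^{-1} and m₀ := P_{𝓗,H₀} ∘ M ∘ ι_{H₀,𝓗}. Define S : 𝓗 → H₀ ⊕ H by Sh := ((P_{𝓗,H₀}∘M − (i/2)·P_Ĥ∘P_{𝓗,H₀})h, −P_{𝓗,H}h); S_* : 𝓗 → H₀ ⊕ H by the same formula with M* in place of M; X : 𝓗 ⊕ 𝓗 → H₀ ⊕ H by X(k, h) := (P_{𝓗,H₀}k + (i/2)·P_Ĥ(P_{𝓗,H₀}h), P_{𝓗,H}h); and Ω̃_τ : 𝓗 ⊕ 𝓗 → 𝓗 ⊕ 𝓗 by Ω̃_τ(h, k) := ((M − M∘K∘M)h + (−(1/2)·I + M∘K)k, (−(1/2)·I + K∘M)h − Kk). Then Ω₀ − S ∘ K ∘ S_*^* = X ∘ Ω̃_τ ∘ X*. (This is the pointwise operator form of Theorem 1.1 for the case n₊(T_min) = n₋(T_min):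 the Krein-type formula Ω_τ(λ) = Ω₀(λ) − S(λ)(τ(λ) + M(λ))^{-1}S*(λ̄) of (1.23) coincides with the block representation Ω_τ(λ) = X Ω̃_τ(λ) X* of (1.24)–(1.25).) -/
open ContinuousLinearMap

set_option synthInstance.maxHeartbeats 1000000
set_option maxHeartbeats 1000000

noncomputable section

/-- A finite-dimensional Hilbert direct sum is complete. -/
instance l2.instCompleteSpace {A B : Type*}
    [NormedAddCommGroup A] [InnerProductSpace ℂ A] [FiniteDimensional ℂ A]
    [NormedAddCommGroup B] [InnerProductSpace ℂ B] [FiniteDimensional ℂ B] :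
    CompleteSpace (l2 A B) := FiniteDimensional.complete ℂ _

variable {H Hh Hb : Type*}
  [NormedAddCommGroup H] [InnerProductSpace ℂ H] [FiniteDimensional ℂ H]
  [NormedAddCommGroup Hh] [InnerProductSpace ℂ Hh] [FiniteDimensional ℂ Hh]
  [NormedAddCommGroup Hb] [InnerProductSpace ℂ Hb] [FiniteDimensional ℂ Hb]

section helpers

variable {A B : Type*}
  [NormedAddCommGroup A] [InnerProductSpace ℂ A]
  [NormedAddCommGroup B] [InnerProductSpace ℂ B]

theorem fstL_mk2 (a : A) (b : B) : fstL A B (mk2 a b) = a := rfl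
theorem sndL_mk2 (a : A) (b : B) : sndL A B (mk2 a b) = b := rfl
theorem fstL_inlL (a : A) : fstL A B (inlL A B a) = a := rfl
theorem mk2_eta (x : l2 A B) : mk2 (fstL A B x) (sndL A B x) = x := rfl

theorem mk2_sub (a a' : A) (b b' : B) :
    mk2 a b - mk2 a' b' = mk2 (a - a') (b - b') := rfl

theorem inner_inlL (a : A) (x : l2 A B) :
    inner ℂ (inlL A B a) x = inner ℂ a (fstL A B x) := by
  rw [WithLp.prod_inner_apply]
  change inner ℂ a _ + inner ℂ (0 : B) _ = _
  rw [inner_zero_left, add_zero]; rfl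

theorem inner_inrL (b : B) (x : l2 A B) :
    inner ℂ (inrL A B b) x = inner ℂ b (sndL A B x) := by
  rw [WithLp.prod_inner_apply]
  change inner ℂ (0 : A) _ + inner ℂ b _ = _
  rw [inner_zero_left, zero_add]; rfl

theorem inner_mk2' (a : A) (b : B) (x : l2 A B) :
    inner ℂ (mk2 a b) x = inner ℂ a (fstL A B x) + inner ℂ b (sndL A B x) := by
  rw [WithLp.prod_inner_apply]; rfl

theorem inner_PHh' (a b : l2 A B) :
    inner ℂ (inrL A B (sndL A B a)) b = inner ℂ a (inrL A B (sndL A B b)) := by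
  rw [inner_inrL, ← inner_conj_symm a, inner_inrL, inner_conj_symm]

theorem PHh_inl (a : A) : inrL A B (sndL A B (inlL A B a)) = 0 := by
  change inrL A B 0 = 0
  exact map_zero _

theorem PHh_idem (a : l2 A B) :
    inrL A B (sndL A B (inrL A B (sndL A B a))) = inrL A B (sndL A B a) := rfl

end helpers

/-- the pointwise operator form of Theorem 1.1 in the equal-index case:
`Ω₀ − S K S_** = X Ω̃_τ X*` where `K = (τ + M)⁻¹`. -/
theorem statement9
    -- `𝓗 = H₀ ⊕ H_b`
    (M τ : l2 (l2 H Hh) Hb →L[ℂ] l2 (l2 H Hh) Hb)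
    -- `K := (τ + M)⁻¹`
    (K : l2 (l2 H Hh) Hb →L[ℂ] l2 (l2 H Hh) Hb)
    (hK₁ : (τ + M) ∘L K = ContinuousLinearMap.id ℂ (l2 (l2 H Hh) Hb))
    (hK₂ : K ∘L (τ + M) = ContinuousLinearMap.id ℂ (l2 (l2 H Hh) Hb))
    -- `m₀ := P_{𝓗,H₀} ∘ M ∘ ι_{H₀,𝓗}`
    (m₀ : l2 H Hh →L[ℂ] l2 H Hh)
    (hm₀ : m₀ = fstL (l2 H Hh) Hb ∘L M ∘L inlL (l2 H Hh) Hb)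
    -- `S : 𝓗 → H₀ ⊕ H`
    (S : l2 (l2 H Hh) Hb →L[ℂ] l2 (l2 H Hh) H)
    (hS : ∀ h : l2 (l2 H Hh) Hb,
      S h = mk2 ((fstL (l2 H Hh) Hb ∘L M -
          (Complex.I / 2) • (PHh ∘L fstL (l2 H Hh) Hb)) h)
        (-(fstL H Hh (fstL (l2 H Hh) Hb h))))
    -- `S_* : 𝓗 → H₀ ⊕ H`, the same formula with `M*` in place of `M`
    (Ss : l2 (l2 H Hh) Hb →L[ℂ] l2 (l2 H Hh) H)
    (hSs : ∀ h : l2 (l2 H Hh) Hb,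
      Ss h = mk2 ((fstL (l2 H Hh) Hb ∘L adjoint M -
          (Complex.I / 2) • (PHh ∘L fstL (l2 H Hh) Hb)) h)
        (-(fstL H Hh (fstL (l2 H Hh) Hb h))))
    -- `X : 𝓗 ⊕ 𝓗 → H₀ ⊕ H`
    (X : l2 (l2 (l2 H Hh) Hb) (l2 (l2 H Hh) Hb) →L[ℂ] l2 (l2 H Hh) H)
    (hX : ∀ (k h : l2 (l2 H Hh) Hb),
      X (mk2 k h) = mk2
        (fstL (l2 H Hh) Hb k + (Complex.I / 2) • PHh (fstL (l2 H Hh) Hb h))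
        (fstL H Hh (fstL (l2 H Hh) Hb h)))
    -- `Ω̃_τ : 𝓗 ⊕ 𝓗 → 𝓗 ⊕ 𝓗`
    (Ωt : l2 (l2 (l2 H Hh) Hb) (l2 (l2 H Hh) Hb) →L[ℂ]
      l2 (l2 (l2 H Hh) Hb) (l2 (l2 H Hh) Hb))
    (hΩt : ∀ (h k : l2 (l2 H Hh) Hb),
      Ωt (mk2 h k) = mk2
        ((M - M ∘L K ∘L M) h +
          (-((1 / 2 : ℂ) • ContinuousLinearMap.id ℂ (l2 (l2 H Hh) Hb)) + M ∘L K) k)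
        ((-((1 / 2 : ℂ) • ContinuousLinearMap.id ℂ (l2 (l2 H Hh) Hb)) + K ∘L M) h - K k))
    -- `Ω₀ : H₀ ⊕ H → H₀ ⊕ H`
    (Ω₀ : l2 (l2 H Hh) H →L[ℂ] l2 (l2 H Hh) H)
    (hΩ₀ : ∀ (h₀ : l2 H Hh) (y : H),
      Ω₀ (mk2 h₀ y) = mk2 (m₀ h₀ - (1 / 2 : ℂ) • inlL H Hh y) (-(1 / 2 : ℂ) • fstL H Hh h₀)) :
    Ω₀ - S ∘L K ∘L adjoint Ss = X ∘L Ωt ∘L adjoint X := by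
  subst hm₀
  have hPi : ∀ a b : l2 H Hh, inner ℂ (PHh a) b = inner ℂ a (PHh b) := inner_PHh'
  have hXs : ∀ (h₀ : l2 H Hh) (y : H), adjoint X (mk2 h₀ y) =
      mk2 (inlL (l2 H Hh) Hb h₀)
        (inlL (l2 H Hh) Hb (-(Complex.I / 2) • PHh h₀ + inlL H Hh y)) := by
    intro h₀ y
    refine ext_inner_right ℂ fun v => ?_
    rw [adjoint_inner_left, ← mk2_eta v, hX, inner_mk2', inner_mk2']
    simp only [fstL_mk2, sndL_mk2, inner_inlL, inner_add_left, inner_add_right,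
      inner_smul_left, inner_smul_right, hPi, map_neg, map_div₀, Complex.conj_I, map_ofNat]
    ring
  have hSss : ∀ (h₀ : l2 H Hh) (y : H), adjoint Ss (mk2 h₀ y) =
      M (inlL (l2 H Hh) Hb h₀) -
        inlL (l2 H Hh) Hb (-(Complex.I / 2) • PHh h₀ + inlL H Hh y) := by
    intro h₀ y
    refine ext_inner_right ℂ fun v => ?_
    rw [adjoint_inner_left, hSs, inner_mk2', inner_sub_left, ← adjoint_inner_right M]
    simp only [fstL_mk2, sndL_mk2, inner_inlL, inner_add_left, inner_sub_right, sub_apply,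
      comp_apply, smul_apply, inner_neg_right,
      inner_smul_left, inner_smul_right, hPi, map_neg, map_div₀, Complex.conj_I, map_ofNat]
    ring
  ext1 x
  obtain ⟨h₀, y, rfl⟩ : ∃ h₀ y, x = mk2 h₀ y := ⟨_, _, (mk2_eta x).symm⟩
  have h1 : PHh (inlL H Hh y) = 0 := PHh_inl y
  simp only [sub_apply, comp_apply]
  rw [hXs, hSss, hΩ₀, hΩt, hX, hS, mk2_sub]
  congr 1
  · simp only [sub_apply, add_apply, neg_apply, smul_apply, comp_apply, id_apply, map_sub,
      map_add, map_neg, map_smul, fstL_inlL]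
    module
  · simp only [sub_apply, add_apply, neg_apply, smul_apply, comp_apply, id_apply, map_sub,
      map_add, map_neg, map_smul, fstL_inlL]
    module
end
end

section
/- Let M, τ : 𝓗 → 𝓗 be bounded operators such that τ + M is boundedly invertible. For bounded operators A, B : 𝓗 → 𝓗 with A + B boundedly invertible, write Ω̃(A, B) : 𝓗 ⊕ 𝓗 → 𝓗 ⊕ 𝓗 for the block operator Ω̃(A, B)(h, k) := ((A − A∘(B + A)^{-1}∘A)h + (−(1/2)·I + A∘(B + A)^{-1})k, (−(1/2)·I + (B + A)^{-1}∘A)h − (B + A)^{-1}k). Then τ* + M* is boundedly invertible and Ω̃(M, τ)* = Ω̃(M*, τ*). (This is the symmetry Ω̃_τ(λ)* = Ω̃_τ(λ̄), part of the assertion in Theorem 1.1 that the operator function Ω̃_τ of (1.25) is a Nevanlinna function, since M(λ̄) = M(λ)* and τ(λ̄) = τ(λ)* for Nevanlinna functions M and τ.) -/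
open ContinuousLinearMap

noncomputable section

variable {𝓗 : Type*} [NormedAddCommGroup 𝓗] [InnerProductSpace ℂ 𝓗] [CompleteSpace 𝓗]

/-- the symmetry `Ω̃(M, τ)* = Ω̃(M*, τ*)` of the block operator of (1.25).
If `τ + M` is boundedly invertible with inverse `W`, then `τ* + M*` is boundedly invertible
(with inverse `W*`), and the adjoint of the block operator `Ω̃(M, τ)` (built from `M` and
`(τ + M)⁻¹ = W`) is the block operator `Ω̃(M*, τ*)` (built from `M*` and
`(τ* + M*)⁻¹ = W*`). -/
theorem statement13
    (M τ : 𝓗 →L[ℂ] 𝓗)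
    (W : 𝓗 →L[ℂ] 𝓗)
    (hW₁ : (τ + M) ∘L W = ContinuousLinearMap.id ℂ 𝓗)
    (hW₂ : W ∘L (τ + M) = ContinuousLinearMap.id ℂ 𝓗)
    -- `Ω = Ω̃(M, τ)`
    (Ω : l2 𝓗 𝓗 →L[ℂ] l2 𝓗 𝓗)
    (hΩ : ∀ h k : 𝓗,
      Ω (mk2 h k) = mk2
        ((M - M ∘L W ∘L M) h + (-((1 / 2 : ℂ) • ContinuousLinearMap.id ℂ 𝓗) + M ∘L W) k)
        ((-((1 / 2 : ℂ) • ContinuousLinearMap.id ℂ 𝓗) + W ∘L M) h - W k))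
    -- `Ω' = Ω̃(M*, τ*)`
    (Ω' : l2 𝓗 𝓗 →L[ℂ] l2 𝓗 𝓗)
    (hΩ' : ∀ h k : 𝓗,
      Ω' (mk2 h k) = mk2
        ((adjoint M - adjoint M ∘L adjoint W ∘L adjoint M) h +
          (-((1 / 2 : ℂ) • ContinuousLinearMap.id ℂ 𝓗) + adjoint M ∘L adjoint W) k)
        ((-((1 / 2 : ℂ) • ContinuousLinearMap.id ℂ 𝓗) + adjoint W ∘L adjoint M) h -
          adjoint W k)) :
    ((adjoint τ + adjoint M) ∘L adjoint W = ContinuousLinearMap.id ℂ 𝓗 ∧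
      adjoint W ∘L (adjoint τ + adjoint M) = ContinuousLinearMap.id ℂ 𝓗) ∧
    adjoint Ω = Ω' := by
  refine ⟨⟨?_, ?_⟩, ?_⟩
  · have h := congrArg adjoint hW₂
    rw [adjoint_comp, map_add, adjoint_id] at h
    exact h
  · have h := congrArg adjoint hW₁
    rw [adjoint_comp, map_add, adjoint_id] at h
    exact h
  · symm
    rw [eq_adjoint_iff]
    intro x y
    have hx : x = mk2 x.fst x.snd := rfl
    have hy : y = mk2 y.fst y.snd := rfl
    have key : ∀ a b c d : 𝓗, inner ℂ (mk2 a b) (mk2 c d) = inner ℂ a c + inner ℂ b d := by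
      intro a b c d
      rw [WithLp.prod_inner_apply]
      rfl
    rw [hx, hy, hΩ, hΩ', key, key]
    simp only [add_apply, sub_apply, neg_apply, smul_apply, comp_apply, id_apply,
      inner_add_left, inner_add_right, inner_sub_left, inner_sub_right, inner_neg_left,
      inner_neg_right, inner_smul_left, inner_smul_right, adjoint_inner_left]
    simp only [map_div₀, map_one, map_ofNat]
    ring
end
end
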